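/- arXiv:1207.7123 — 7 statements merged into one kernel-verified Lean document; each statement's English description precedes it below -/
import Mathlib

section
/- Let M be a smooth manifold, H a closed 3-form on M, and let D be a C^∞(M)-submodule of the space of sections of TM ⊕ T*M such that ⟨A,B⟩₊ = 0 for all A,B ∈ D (isotropy) and [A,B]_H ∈ D for all A,B ∈ D (involutivity). Call a smooth function f : M → ℝ H-admissible if there exists a smooth vector field X_f with X_f ⊕ df ∈ D and i_{X_f}H = 0. Then: (i) for H-admissible f and g the value {f,g} := X_f(g) does not depend on the choice of such X_f; (ii) if f,g are H-admissible then so is fg, with Hamiltonian vector field gX_f + fX_g; (iii) if f,g are H-admissible then so is {f,g}, with Hamiltonian vector field [X_f,X_g]; (iv) the bracket {·,·} is ℝ-bilinear, antisymmetric, satisfies the Leibniz rule {fg,h} = f{g,h} + g{f,h} and the Jacobi identity {f,{g,h}} + {g,{h,f}} + {h,{f,g}} = 0. Hence the set of H-admissible functions is a Poisson algebra. -/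
/-!
Abstract Cartan calculus on a smooth manifold `M`, in low degrees.

`C` plays the role of the ring of smooth functions `C^∞(M)`, `V` of the smooth
vector fields `𝔛(M)`, and `Ωk` of the smooth differential `k`-forms on `M`
(`k = 1, 2, 3, 4`), together with the Lie bracket `lie` of vector fields, the
exterior derivative `d` (`dC` on functions, `dk` on `k`-forms), and the
interior product `ι` (`ιk` contracting a `k`-form with a vector field), subject
to the standard identities of Cartan calculus.  The Lie derivative is recovered
by Cartan's magic formula `L_X = d ∘ i_X + i_X ∘ d`, and the action of a vector
field on a function is `X(f) = i_X (df)`; the fields `ι1_lie`, `ι2_lie`,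
`ι3_lie` express the standard identity `i_{[X,Y]} = L_X ∘ i_Y - i_Y ∘ L_X` with
the Lie derivatives expanded through Cartan's magic formula, and `ext1`, `ext2`,
`ext3` express that a differential form vanishes iff all its contractions with
vector fields vanish.
-/
structure CartanCalculus (C V Ω1 Ω2 Ω3 Ω4 : Type*) [CommRing C] [Algebra ℝ C]
    [AddCommGroup V] [Module ℝ V] [Module C V] [IsScalarTower ℝ C V]
    [AddCommGroup Ω1] [Module ℝ Ω1] [Module C Ω1] [IsScalarTower ℝ C Ω1]
    [AddCommGroup Ω2] [Module ℝ Ω2] [Module C Ω2] [IsScalarTower ℝ C Ω2]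
    [AddCommGroup Ω3] [Module ℝ Ω3] [Module C Ω3] [IsScalarTower ℝ C Ω3]
    [AddCommGroup Ω4] [Module ℝ Ω4] [Module C Ω4] [IsScalarTower ℝ C Ω4] where
  /-- the Lie bracket of vector fields -/
  lie : V →ₗ[ℝ] V →ₗ[ℝ] V
  /-- the exterior derivative (differential) of a smooth function -/
  dC : C →ₗ[ℝ] Ω1
  /-- the exterior derivative on 1-forms -/
  d1 : Ω1 →ₗ[ℝ] Ω2
  /-- the exterior derivative on 2-forms -/
  d2 : Ω2 →ₗ[ℝ] Ω3
  /-- the exterior derivative on 3-forms -/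
  d3 : Ω3 →ₗ[ℝ] Ω4
  /-- the interior product of a vector field with a 1-form (the duality pairing) -/
  ι1 : V →ₗ[ℝ] Ω1 →ₗ[ℝ] C
  /-- the interior product of a vector field with a 2-form -/
  ι2 : V →ₗ[ℝ] Ω2 →ₗ[ℝ] Ω1
  /-- the interior product of a vector field with a 3-form -/
  ι3 : V →ₗ[ℝ] Ω3 →ₗ[ℝ] Ω2
  /-- the interior product of a vector field with a 4-form -/
  ι4 : V →ₗ[ℝ] Ω4 →ₗ[ℝ] Ω3
  lie_skew : ∀ X Y, lie X Y = - lie Y X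
  lie_jacobi : ∀ X Y Z, lie (lie X Y) Z = lie X (lie Y Z) - lie Y (lie X Z)
  lie_smul_right : ∀ (f : C) (X Y : V), lie X (f • Y) = f • lie X Y + (ι1 X (dC f)) • Y
  /-- Leibniz rule for the differential of a product of functions -/
  dC_mul : ∀ f g : C, dC (f * g) = f • dC g + g • dC f
  d1_dC : ∀ f, d1 (dC f) = 0
  d2_d1 : ∀ ω, d2 (d1 ω) = 0
  d3_d2 : ∀ ω, d3 (d2 ω) = 0
  ι1_smul_left : ∀ (f : C) (X : V) (ω : Ω1), ι1 (f • X) ω = f * ι1 X ω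
  ι1_smul_right : ∀ (f : C) (X : V) (ω : Ω1), ι1 X (f • ω) = f * ι1 X ω
  ι2_smul_left : ∀ (f : C) (X : V) (ω : Ω2), ι2 (f • X) ω = f • ι2 X ω
  ι2_smul_right : ∀ (f : C) (X : V) (ω : Ω2), ι2 X (f • ω) = f • ι2 X ω
  ι3_smul_left : ∀ (f : C) (X : V) (ω : Ω3), ι3 (f • X) ω = f • ι3 X ω
  ι3_smul_right : ∀ (f : C) (X : V) (ω : Ω3), ι3 X (f • ω) = f • ι3 X ω
  ι4_smul_left : ∀ (f : C) (X : V) (ω : Ω4), ι4 (f • X) ω = f • ι4 X ω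
  ι4_smul_right : ∀ (f : C) (X : V) (ω : Ω4), ι4 X (f • ω) = f • ι4 X ω
  ι1_ι2 : ∀ (X : V) (ω : Ω2), ι1 X (ι2 X ω) = 0
  ι2_ι3 : ∀ (X : V) (ω : Ω3), ι2 X (ι3 X ω) = 0
  ι3_ι4 : ∀ (X : V) (ω : Ω4), ι3 X (ι4 X ω) = 0
  ι1_lie : ∀ (X Y : V) (ω : Ω1), ι1 (lie X Y) ω
      = ι1 X (dC (ι1 Y ω)) - ι1 Y (dC (ι1 X ω) + ι2 X (d1 ω))
  ι2_lie : ∀ (X Y : V) (ω : Ω2), ι2 (lie X Y) ω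
      = (dC (ι1 X (ι2 Y ω)) + ι2 X (d1 (ι2 Y ω)))
        - ι2 Y (d1 (ι2 X ω) + ι3 X (d2 ω))
  ι3_lie : ∀ (X Y : V) (ω : Ω3), ι3 (lie X Y) ω
      = (d1 (ι2 X (ι3 Y ω)) + ι3 X (d2 (ι3 Y ω)))
        - ι3 Y (d2 (ι3 X ω) + ι4 X (d3 ω))
  ext1 : ∀ ω : Ω1, (∀ X : V, ι1 X ω = 0) → ω = 0
  ext2 : ∀ ω : Ω2, (∀ X : V, ι2 X ω = 0) → ω = 0
  ext3 : ∀ ω : Ω3, (∀ X : V, ι3 X ω = 0) → ω = 0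

namespace CartanCalculus

variable {C V Ω1 Ω2 Ω3 Ω4 : Type*} [CommRing C] [Algebra ℝ C]
    [AddCommGroup V] [Module ℝ V] [Module C V] [IsScalarTower ℝ C V]
    [AddCommGroup Ω1] [Module ℝ Ω1] [Module C Ω1] [IsScalarTower ℝ C Ω1]
    [AddCommGroup Ω2] [Module ℝ Ω2] [Module C Ω2] [IsScalarTower ℝ C Ω2]
    [AddCommGroup Ω3] [Module ℝ Ω3] [Module C Ω3] [IsScalarTower ℝ C Ω3]
    [AddCommGroup Ω4] [Module ℝ Ω4] [Module C Ω4] [IsScalarTower ℝ C Ω4]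
    (𝓓 : CartanCalculus C V Ω1 Ω2 Ω3 Ω4)

/-- The action `X(f) = i_X (df)` of a vector field on a smooth function. -/
def act (X : V) (f : C) : C := 𝓓.ι1 X (𝓓.dC f)

/-- The Lie derivative of a 1-form along a vector field, via Cartan's magic
formula `L_X = d ∘ i_X + i_X ∘ d`. -/
def L1 (X : V) (ω : Ω1) : Ω1 := 𝓓.dC (𝓓.ι1 X ω) + 𝓓.ι2 X (𝓓.d1 ω)

/-- The Lie derivative of a 2-form along a vector field, via Cartan's magic
formula `L_X = d ∘ i_X + i_X ∘ d`. -/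
def L2 (X : V) (ω : Ω2) : Ω2 := 𝓓.d1 (𝓓.ι2 X ω) + 𝓓.ι3 X (𝓓.d2 ω)

/-- The symmetric pairing `⟨X ⊕ ξ, Y ⊕ η⟩₊ = ½ (ξ(Y) + η(X))` on sections of
the generalized tangent bundle `TM ⊕ T*M`. -/
noncomputable def pairPlus (A B : V × Ω1) : C := (2⁻¹ : ℝ) • (𝓓.ι1 B.1 A.2 + 𝓓.ι1 A.1 B.2)

/-- The (untwisted) Courant bracket
`[X ⊕ ξ, Y ⊕ η]_C = [X,Y] ⊕ (L_X η − L_Y ξ − ½ d(i_X η − i_Y ξ))`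
on sections of `TM ⊕ T*M`. -/
noncomputable def courant (A B : V × Ω1) : V × Ω1 :=
  (𝓓.lie A.1 B.1,
    𝓓.L1 A.1 B.2 - 𝓓.L1 B.1 A.2 - (2⁻¹ : ℝ) • 𝓓.dC (𝓓.ι1 A.1 B.2 - 𝓓.ι1 B.1 A.2))

/-- The `H`-twisted Courant bracket
`[X ⊕ ξ, Y ⊕ η]_H = [X ⊕ ξ, Y ⊕ η]_C − i_Y i_X H` on sections of `TM ⊕ T*M`. -/
noncomputable def courantH (H : Ω3) (A B : V × Ω1) : V × Ω1 :=
  ((𝓓.courant A B).1, (𝓓.courant A B).2 - 𝓓.ι2 B.1 (𝓓.ι3 A.1 H))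

end CartanCalculus

open CartanCalculus

/-- `X` is a Hamiltonian vector field for the function `f` with respect to the
`H`-twisted Dirac structure `D ≤ Γ(TM ⊕ T*M)`: the pair `X ⊕ df` is a section
of `D` and `i_X H = 0`.  A smooth function is `H`-admissible when it admits
such a Hamiltonian vector field. -/
def IsHamiltonianFor
    {C V Ω1 Ω2 Ω3 Ω4 : Type*} [CommRing C] [Algebra ℝ C]
    [AddCommGroup V] [Module ℝ V] [Module C V] [IsScalarTower ℝ C V]
    [AddCommGroup Ω1] [Module ℝ Ω1] [Module C Ω1] [IsScalarTower ℝ C Ω1]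
    [AddCommGroup Ω2] [Module ℝ Ω2] [Module C Ω2] [IsScalarTower ℝ C Ω2]
    [AddCommGroup Ω3] [Module ℝ Ω3] [Module C Ω3] [IsScalarTower ℝ C Ω3]
    [AddCommGroup Ω4] [Module ℝ Ω4] [Module C Ω4] [IsScalarTower ℝ C Ω4]
    (𝓓 : CartanCalculus C V Ω1 Ω2 Ω3 Ω4)
    (H : Ω3) (D : Submodule C (V × Ω1)) (f : C) (X : V) : Prop :=
  (X, 𝓓.dC f) ∈ D ∧ 𝓓.ι3 X H = 0

/-- The commutator formula `[X,Y](h) = X(Y(h)) - Y(X(h))`. -/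
theorem CartanCalculus.act_lie
    {C V Ω1 Ω2 Ω3 Ω4 : Type*} [CommRing C] [Algebra ℝ C]
    [AddCommGroup V] [Module ℝ V] [Module C V] [IsScalarTower ℝ C V]
    [AddCommGroup Ω1] [Module ℝ Ω1] [Module C Ω1] [IsScalarTower ℝ C Ω1]
    [AddCommGroup Ω2] [Module ℝ Ω2] [Module C Ω2] [IsScalarTower ℝ C Ω2]
    [AddCommGroup Ω3] [Module ℝ Ω3] [Module C Ω3] [IsScalarTower ℝ C Ω3]
    [AddCommGroup Ω4] [Module ℝ Ω4] [Module C Ω4] [IsScalarTower ℝ C Ω4]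
    {𝓓 : CartanCalculus C V Ω1 Ω2 Ω3 Ω4} (X Y : V) (h : C) :
    𝓓.act (𝓓.lie X Y) h = 𝓓.act X (𝓓.act Y h) - 𝓓.act Y (𝓓.act X h) := by
  simp [act, 𝓓.ι1_lie, 𝓓.d1_dC]

/-- Isotropy makes the bracket of admissible functions antisymmetric. -/
theorem IsHamiltonianFor.act_antisymm
    {C V Ω1 Ω2 Ω3 Ω4 : Type*} [CommRing C] [Algebra ℝ C]
    [AddCommGroup V] [Module ℝ V] [Module C V] [IsScalarTower ℝ C V]
    [AddCommGroup Ω1] [Module ℝ Ω1] [Module C Ω1] [IsScalarTower ℝ C Ω1]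
    [AddCommGroup Ω2] [Module ℝ Ω2] [Module C Ω2] [IsScalarTower ℝ C Ω2]
    [AddCommGroup Ω3] [Module ℝ Ω3] [Module C Ω3] [IsScalarTower ℝ C Ω3]
    [AddCommGroup Ω4] [Module ℝ Ω4] [Module C Ω4] [IsScalarTower ℝ C Ω4]
    {𝓓 : CartanCalculus C V Ω1 Ω2 Ω3 Ω4} {H : Ω3} {D : Submodule C (V × Ω1)}
    (hiso : ∀ A ∈ D, ∀ B ∈ D, 𝓓.pairPlus A B = 0) {f g : C} {Xf Xg : V}
    (hf : IsHamiltonianFor 𝓓 H D f Xf) (hg : IsHamiltonianFor 𝓓 H D g Xg) :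
    𝓓.act Xf g = - 𝓓.act Xg f := by
  have h : (2⁻¹ : ℝ) • (𝓓.act Xg f + 𝓓.act Xf g) = 0 := hiso _ hf.1 _ hg.1
  have h' := congrArg (fun c : C => (2 : ℝ) • c) h
  simp only [smul_smul, smul_zero] at h'
  norm_num at h'
  linear_combination h'

/-- The product of admissible functions is admissible. -/
theorem IsHamiltonianFor.mul
    {C V Ω1 Ω2 Ω3 Ω4 : Type*} [CommRing C] [Algebra ℝ C]
    [AddCommGroup V] [Module ℝ V] [Module C V] [IsScalarTower ℝ C V]
    [AddCommGroup Ω1] [Module ℝ Ω1] [Module C Ω1] [IsScalarTower ℝ C Ω1]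
    [AddCommGroup Ω2] [Module ℝ Ω2] [Module C Ω2] [IsScalarTower ℝ C Ω2]
    [AddCommGroup Ω3] [Module ℝ Ω3] [Module C Ω3] [IsScalarTower ℝ C Ω3]
    [AddCommGroup Ω4] [Module ℝ Ω4] [Module C Ω4] [IsScalarTower ℝ C Ω4]
    {𝓓 : CartanCalculus C V Ω1 Ω2 Ω3 Ω4} {H : Ω3} {D : Submodule C (V × Ω1)} {f g : C} {Xf Xg : V}
    (hf : IsHamiltonianFor 𝓓 H D f Xf) (hg : IsHamiltonianFor 𝓓 H D g Xg) :
    IsHamiltonianFor 𝓓 H D (f * g) (g • Xf + f • Xg) := by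
  refine ⟨?_, ?_⟩
  · have h := D.add_mem (D.smul_mem g hf.1) (D.smul_mem f hg.1)
    simpa [𝓓.dC_mul, add_comm] using h
  · simp [𝓓.ι3_smul_left, hf.2, hg.2]

/-- The commutator of Hamiltonian vector fields is Hamiltonian for the bracket. -/
theorem IsHamiltonianFor.lie
    {C V Ω1 Ω2 Ω3 Ω4 : Type*} [CommRing C] [Algebra ℝ C]
    [AddCommGroup V] [Module ℝ V] [Module C V] [IsScalarTower ℝ C V]
    [AddCommGroup Ω1] [Module ℝ Ω1] [Module C Ω1] [IsScalarTower ℝ C Ω1]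
    [AddCommGroup Ω2] [Module ℝ Ω2] [Module C Ω2] [IsScalarTower ℝ C Ω2]
    [AddCommGroup Ω3] [Module ℝ Ω3] [Module C Ω3] [IsScalarTower ℝ C Ω3]
    [AddCommGroup Ω4] [Module ℝ Ω4] [Module C Ω4] [IsScalarTower ℝ C Ω4]
    {𝓓 : CartanCalculus C V Ω1 Ω2 Ω3 Ω4} {H : Ω3} {D : Submodule C (V × Ω1)}
    (hHcl : 𝓓.d3 H = 0)
    (hinv : ∀ A ∈ D, ∀ B ∈ D, 𝓓.courantH H A B ∈ D)
    (hiso : ∀ A ∈ D, ∀ B ∈ D, 𝓓.pairPlus A B = 0) {f g : C} {Xf Xg : V}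
    (hf : IsHamiltonianFor 𝓓 H D f Xf) (hg : IsHamiltonianFor 𝓓 H D g Xg) :
    IsHamiltonianFor 𝓓 H D (𝓓.act Xf g) (𝓓.lie Xf Xg) := by
  refine ⟨?_, ?_⟩
  · have h := hinv _ hf.1 _ hg.1
    have hs : 𝓓.ι1 Xg (𝓓.dC f) = - 𝓓.ι1 Xf (𝓓.dC g) := hg.act_antisymm hiso hf
    convert h using 1
    simp only [courantH, courant, L1, act, 𝓓.d1_dC, hf.2, hs, map_zero, map_neg, map_sub,
      add_zero, sub_zero]
    congr 1
    module
  · simp [𝓓.ι3_lie, hf.2, hg.2, hHcl]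

/-- An `ℝ`-linear combination of admissible functions is admissible. -/
theorem IsHamiltonianFor.smul_add
    {C V Ω1 Ω2 Ω3 Ω4 : Type*} [CommRing C] [Algebra ℝ C]
    [AddCommGroup V] [Module ℝ V] [Module C V] [IsScalarTower ℝ C V]
    [AddCommGroup Ω1] [Module ℝ Ω1] [Module C Ω1] [IsScalarTower ℝ C Ω1]
    [AddCommGroup Ω2] [Module ℝ Ω2] [Module C Ω2] [IsScalarTower ℝ C Ω2]
    [AddCommGroup Ω3] [Module ℝ Ω3] [Module C Ω3] [IsScalarTower ℝ C Ω3]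
    [AddCommGroup Ω4] [Module ℝ Ω4] [Module C Ω4] [IsScalarTower ℝ C Ω4]
    {𝓓 : CartanCalculus C V Ω1 Ω2 Ω3 Ω4} {H : Ω3} {D : Submodule C (V × Ω1)} {f g : C} {Xf Xg : V}
    (a : ℝ) (hf : IsHamiltonianFor 𝓓 H D f Xf) (hg : IsHamiltonianFor 𝓓 H D g Xg) :
    IsHamiltonianFor 𝓓 H D (a • f + g) (a • Xf + Xg) := by
  refine ⟨?_, ?_⟩
  · have h := D.add_mem (D.smul_of_tower_mem a hf.1) hg.1
    simpa using h
  · simp [hf.2, hg.2]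

/-- Let `H` be a closed 3-form and let `D` be a
`C^∞(M)`-submodule of the sections of `TM ⊕ T*M` which is isotropic for the
symmetric pairing `⟨·,·⟩₊` and involutive for the `H`-twisted Courant bracket.
Then, on the `H`-admissible functions (those `f` admitting a Hamiltonian vector
field `X_f` with `X_f ⊕ df ∈ D` and `i_{X_f} H = 0`), the bracket
`{f, g} = X_f(g)`:
(i) is independent of the choice of Hamiltonian vector field;
(ii) makes the product `fg` `H`-admissible, with Hamiltonian vector field
`g X_f + f X_g`;
(iii) makes `{f, g}` `H`-admissible, with Hamiltonian vector field `[X_f, X_g]`;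
(iv) is ℝ-bilinear, antisymmetric, and satisfies the Leibniz rule and the
Jacobi identity.
Hence the set of `H`-admissible functions is a Poisson algebra. -/
theorem poisson_algebra_of_H_admissible_functions
    {C V Ω1 Ω2 Ω3 Ω4 : Type*} [CommRing C] [Algebra ℝ C]
    [AddCommGroup V] [Module ℝ V] [Module C V] [IsScalarTower ℝ C V]
    [AddCommGroup Ω1] [Module ℝ Ω1] [Module C Ω1] [IsScalarTower ℝ C Ω1]
    [AddCommGroup Ω2] [Module ℝ Ω2] [Module C Ω2] [IsScalarTower ℝ C Ω2]
    [AddCommGroup Ω3] [Module ℝ Ω3] [Module C Ω3] [IsScalarTower ℝ C Ω3]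
    [AddCommGroup Ω4] [Module ℝ Ω4] [Module C Ω4] [IsScalarTower ℝ C Ω4]
    (𝓓 : CartanCalculus C V Ω1 Ω2 Ω3 Ω4)
    (H : Ω3) (hHcl : 𝓓.d3 H = 0)
    (D : Submodule C (V × Ω1))
    (hiso : ∀ A ∈ D, ∀ B ∈ D, 𝓓.pairPlus A B = 0)
    (hinv : ∀ A ∈ D, ∀ B ∈ D, 𝓓.courantH H A B ∈ D) :
    -- (i) `{f,g} := X_f(g)` does not depend on the choice of `X_f`
    (∀ (f g : C) (Xf Xf' Xg : V),
        IsHamiltonianFor 𝓓 H D f Xf → IsHamiltonianFor 𝓓 H D f Xf' →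
        IsHamiltonianFor 𝓓 H D g Xg → 𝓓.act Xf g = 𝓓.act Xf' g)
    ∧ -- (ii) products of `H`-admissible functions are `H`-admissible
    (∀ (f g : C) (Xf Xg : V),
        IsHamiltonianFor 𝓓 H D f Xf → IsHamiltonianFor 𝓓 H D g Xg →
        IsHamiltonianFor 𝓓 H D (f * g) (g • Xf + f • Xg))
    ∧ -- (iii) brackets of `H`-admissible functions are `H`-admissible
    (∀ (f g : C) (Xf Xg : V),
        IsHamiltonianFor 𝓓 H D f Xf → IsHamiltonianFor 𝓓 H D g Xg →
        IsHamiltonianFor 𝓓 H D (𝓓.act Xf g) (𝓓.lie Xf Xg))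
    ∧ -- (iv) ℝ-linearity in the first argument
    (∀ (f f' g : C) (Xf Xf' Xg : V) (a : ℝ),
        IsHamiltonianFor 𝓓 H D f Xf → IsHamiltonianFor 𝓓 H D f' Xf' →
        IsHamiltonianFor 𝓓 H D g Xg →
        IsHamiltonianFor 𝓓 H D (a • f + f') (a • Xf + Xf')
        ∧ 𝓓.act (a • Xf + Xf') g = a • 𝓓.act Xf g + 𝓓.act Xf' g)
    ∧ -- (iv) ℝ-linearity in the second argument
    (∀ (f g g' : C) (Xf : V) (a : ℝ), IsHamiltonianFor 𝓓 H D f Xf →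
        𝓓.act Xf (a • g + g') = a • 𝓓.act Xf g + 𝓓.act Xf g')
    ∧ -- (iv) antisymmetry
    (∀ (f g : C) (Xf Xg : V),
        IsHamiltonianFor 𝓓 H D f Xf → IsHamiltonianFor 𝓓 H D g Xg →
        𝓓.act Xf g = - 𝓓.act Xg f)
    ∧ -- (iv) Leibniz rule `{fg, h} = f {g, h} + g {f, h}`
    (∀ (f g h : C) (Xf Xg Xh : V),
        IsHamiltonianFor 𝓓 H D f Xf → IsHamiltonianFor 𝓓 H D g Xg →
        IsHamiltonianFor 𝓓 H D h Xh →
        𝓓.act (g • Xf + f • Xg) h = f * 𝓓.act Xg h + g * 𝓓.act Xf h)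
    ∧ -- (iv) Jacobi identity `{f,{g,h}} + {g,{h,f}} + {h,{f,g}} = 0`
    (∀ (f g h : C) (Xf Xg Xh : V),
        IsHamiltonianFor 𝓓 H D f Xf → IsHamiltonianFor 𝓓 H D g Xg →
        IsHamiltonianFor 𝓓 H D h Xh →
        𝓓.act Xf (𝓓.act Xg h) + 𝓓.act Xg (𝓓.act Xh f)
          + 𝓓.act Xh (𝓓.act Xf g) = 0) := by
  refine ⟨?_, fun f g Xf Xg hf hg => hf.mul hg,
    fun f g Xf Xg hf hg => hf.lie hHcl hinv hiso hg, ?_, ?_,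
    fun f g Xf Xg hf hg => hf.act_antisymm hiso hg, ?_, ?_⟩
  · intro f g Xf Xf' Xg hf hf' hg
    rw [hf.act_antisymm hiso hg, hf'.act_antisymm hiso hg]
  · intro f f' g Xf Xf' Xg a hf hf' _
    exact ⟨hf.smul_add a hf', by simp [act]⟩
  · intro f g g' Xf a _
    simp [act]
  · intro f g h Xf Xg Xh _ _ _
    simp [act, 𝓓.ι1_smul_left, add_comm]
  · intro f g h Xf Xg Xh hf hg hh
    have hfg := (hf.lie hHcl hinv hiso hg).act_antisymm hiso hh
    have hneg : 𝓓.act Xg (𝓓.act Xh f) = - 𝓓.act Xg (𝓓.act Xf h) := by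
      rw [hh.act_antisymm hiso hf]
      simp [act]
    rw [𝓓.act_lie] at hfg
    linear_combination hfg + hneg
end

section
/- Let M be a smooth manifold, h a nondegenerate smooth 2-form on M, and set H := dh. For each smooth function f let X_f be the unique vector field with df + i_{X_f}h = 0, and define {f,g} := X_f(g). Then the set A = {f ∈ C^∞(M) : i_{X_f}H = 0} (equivalently, L_{X_f}h = 0) contains the constants, is closed under products (with X_{fg} = gX_f + fX_g) and under the bracket (with X_{{f,g}} = [X_f,X_g]), and {·,·} restricted to A is ℝ-bilinear, antisymmetric, satisfies the Leibniz rule and the Jacobi identity, so that A is a Poisson algebra. -/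
open CartanCalculus

namespace CartanCalculus

section

variable {C V Ω1 Ω2 Ω3 Ω4 : Type*} [CommRing C] [Algebra ℝ C]
    [AddCommGroup V] [Module ℝ V] [Module C V] [IsScalarTower ℝ C V]
    [AddCommGroup Ω1] [Module ℝ Ω1] [Module C Ω1] [IsScalarTower ℝ C Ω1]
    [AddCommGroup Ω2] [Module ℝ Ω2] [Module C Ω2] [IsScalarTower ℝ C Ω2]
    [AddCommGroup Ω3] [Module ℝ Ω3] [Module C Ω3] [IsScalarTower ℝ C Ω3]
    [AddCommGroup Ω4] [Module ℝ Ω4] [Module C Ω4] [IsScalarTower ℝ C Ω4]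
    (𝓓 : CartanCalculus C V Ω1 Ω2 Ω3 Ω4)

/-- The differential of a constant function vanishes. -/
theorem dC_algebraMap (a : ℝ) : 𝓓.dC (algebraMap ℝ C a) = 0 := by
  have h1 : 𝓓.dC 1 = 0 := by simpa using 𝓓.dC_mul 1 1
  rw [Algebra.algebraMap_eq_smul_one, map_smul, h1, smul_zero]

/-- Contractions of a 2-form with two vector fields anticommute. -/
theorem ι1_ι2_swap (X Y : V) (ω : Ω2) : 𝓓.ι1 X (𝓓.ι2 Y ω) = -𝓓.ι1 Y (𝓓.ι2 X ω) := by
  have hXY := 𝓓.ι1_ι2 (X + Y) ω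
  simp only [map_add, LinearMap.add_apply, 𝓓.ι1_ι2, zero_add, add_zero] at hXY
  linear_combination hXY

/-- The bracket of vector fields acts on functions as the commutator. -/
theorem act_lie_s1 (X Y : V) (f : C) :
    𝓓.act (𝓓.lie X Y) f = 𝓓.act X (𝓓.act Y f) - 𝓓.act Y (𝓓.act X f) := by
  simp [act, 𝓓.ι1_lie, 𝓓.d1_dC]

/-- Vector fields annihilating a closed 3-form are closed under the bracket. -/
theorem ι3_lie_eq_zero {X Y : V} {ω : Ω3} (hω : 𝓓.d3 ω = 0) (hX : 𝓓.ι3 X ω = 0)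
    (hY : 𝓓.ι3 Y ω = 0) : 𝓓.ι3 (𝓓.lie X Y) ω = 0 := by
  simp [𝓓.ι3_lie, hω, hX, hY]

end

end CartanCalculus

/-- Let `h` be a nondegenerate 2-form, `H := dh`, and for each
smooth function `f` let `X_f` be the unique vector field with
`df + i_{X_f} h = 0`; set `{f, g} := X_f(g)`.  Then the set
`A = {f : i_{X_f} H = 0}` (equivalently, `L_{X_f} h = 0`) contains the
constants, is closed under sums, real scalar multiples, products (with
`X_{fg} = g X_f + f X_g`) and the bracket (with `X_{{f,g}} = [X_f, X_g]`), and
on `A` the bracket is ℝ-bilinear, antisymmetric and satisfies the Leibniz rule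
and the Jacobi identity: `A` is a Poisson algebra. -/
theorem twisted_symplectic_graph_admissible_poisson
    {C V Ω1 Ω2 Ω3 Ω4 : Type*} [CommRing C] [Algebra ℝ C]
    [AddCommGroup V] [Module ℝ V] [Module C V] [IsScalarTower ℝ C V]
    [AddCommGroup Ω1] [Module ℝ Ω1] [Module C Ω1] [IsScalarTower ℝ C Ω1]
    [AddCommGroup Ω2] [Module ℝ Ω2] [Module C Ω2] [IsScalarTower ℝ C Ω2]
    [AddCommGroup Ω3] [Module ℝ Ω3] [Module C Ω3] [IsScalarTower ℝ C Ω3]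
    [AddCommGroup Ω4] [Module ℝ Ω4] [Module C Ω4] [IsScalarTower ℝ C Ω4]
    (𝓓 : CartanCalculus C V Ω1 Ω2 Ω3 Ω4)
    (h : Ω2) (hnd : ∀ X : V, 𝓓.ι2 X h = 0 → X = 0)
    (Xf : C → V)
    (hXf : ∀ f : C, 𝓓.dC f + 𝓓.ι2 (Xf f) h = 0)
    (hXfu : ∀ (f : C) (Y : V), 𝓓.dC f + 𝓓.ι2 Y h = 0 → Y = Xf f)
    (H : Ω3) (hHdef : H = 𝓓.d2 h)
    (A : Set C) (hAdef : A = {f : C | 𝓓.ι3 (Xf f) H = 0}) :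
    -- membership in `A` is equivalent to `L_{X_f} h = 0`
    (∀ f : C, f ∈ A ↔ 𝓓.L2 (Xf f) h = 0)
    ∧ -- `A` contains the constant functions
    (∀ a : ℝ, (algebraMap ℝ C a) ∈ A)
    ∧ -- `A` is closed under sums and real scalar multiples
    (∀ f ∈ A, ∀ g ∈ A, f + g ∈ A) ∧ (∀ a : ℝ, ∀ f ∈ A, a • f ∈ A)
    ∧ -- `A` is closed under products, with `X_{fg} = g X_f + f X_g`
    (∀ f ∈ A, ∀ g ∈ A, f * g ∈ A ∧ Xf (f * g) = g • Xf f + f • Xf g)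
    ∧ -- `A` is closed under the bracket, with `X_{{f,g}} = [X_f, X_g]`
    (∀ f ∈ A, ∀ g ∈ A,
        𝓓.act (Xf f) g ∈ A ∧ Xf (𝓓.act (Xf f) g) = 𝓓.lie (Xf f) (Xf g))
    ∧ -- ℝ-bilinearity of the bracket on `A`
    (∀ f ∈ A, ∀ f' ∈ A, ∀ g ∈ A, ∀ a : ℝ,
        𝓓.act (Xf (a • f + f')) g = a • 𝓓.act (Xf f) g + 𝓓.act (Xf f') g
        ∧ 𝓓.act (Xf g) (a • f + f') = a • 𝓓.act (Xf g) f + 𝓓.act (Xf g) f')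
    ∧ -- antisymmetry on `A`
    (∀ f ∈ A, ∀ g ∈ A, 𝓓.act (Xf f) g = - 𝓓.act (Xf g) f)
    ∧ -- Leibniz rule on `A`
    (∀ f ∈ A, ∀ g ∈ A, ∀ k ∈ A,
        𝓓.act (Xf (f * g)) k = f * 𝓓.act (Xf g) k + g * 𝓓.act (Xf f) k)
    ∧ -- Jacobi identity on `A`
    (∀ f ∈ A, ∀ g ∈ A, ∀ k ∈ A,
        𝓓.act (Xf f) (𝓓.act (Xf g) k) + 𝓓.act (Xf g) (𝓓.act (Xf k) f)
          + 𝓓.act (Xf k) (𝓓.act (Xf f) g) = 0) := by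
  subst hHdef hAdef
  have hι (f : C) : 𝓓.ι2 (Xf f) h = -𝓓.dC f := eq_neg_of_add_eq_zero_right (hXf f)
  have hadd (f g : C) : Xf (f + g) = Xf f + Xf g :=
    (hXfu _ _ (by simp only [map_add, LinearMap.add_apply, hι]; abel)).symm
  have hsmul (a : ℝ) (f : C) : Xf (a • f) = a • Xf f :=
    (hXfu _ _ (by simp [hι])).symm
  have hmul (f g : C) : Xf (f * g) = g • Xf f + f • Xf g :=
    (hXfu _ _ (by
      simp only [map_add, LinearMap.add_apply, 𝓓.ι2_smul_left, hι, 𝓓.dC_mul, smul_neg]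
      abel)).symm
  have hskew (f g : C) : 𝓓.act (Xf f) g = -𝓓.act (Xf g) f := by
    simpa [act, hι] using congrArg Neg.neg (𝓓.ι1_ι2_swap (Xf f) (Xf g) h)
  have hlie (f g : C) (hf : 𝓓.ι3 (Xf f) (𝓓.d2 h) = 0) :
      Xf (𝓓.act (Xf f) g) = 𝓓.lie (Xf f) (Xf g) :=
    (hXfu _ _ (by simp [𝓓.ι2_lie, hι, hf, 𝓓.d1_dC, act])).symm
  simp only [Set.mem_ofPred_eq]
  refine ⟨fun f => ?_, fun a => ?_, fun f hf g hg => ?_, fun a f hf => ?_,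
    fun f hf g hg => ⟨?_, hmul f g⟩, fun f hf g hg => ⟨?_, hlie f g hf⟩,
    fun f _ f' _ g _ a => ⟨?_, ?_⟩, fun f _ g _ => hskew f g,
    fun f _ g _ k _ => ?_, fun f hf g _ k _ => ?_⟩
  · simp [L2, hι, 𝓓.d1_dC]
  · have h0 : Xf (algebraMap ℝ C a) = 0 := hnd _ (by rw [hι, 𝓓.dC_algebraMap, neg_zero])
    simp [h0]
  · simp [hadd, hf, hg]
  · simp [hsmul, hf]
  · simp [hmul, 𝓓.ι3_smul_left, hf, hg]
  · rw [hlie f g hf]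
    exact 𝓓.ι3_lie_eq_zero (𝓓.d3_d2 h) hf hg
  · simp [act, hadd, hsmul]
  · simp [act]
  · simp only [act, hmul, map_add, LinearMap.add_apply, 𝓓.ι1_smul_left]
    ring
  · have hfgk := 𝓓.act_lie_s1 (Xf f) (Xf g) k
    rw [← hlie f g hf, hskew _ k] at hfgk
    have hgkf : 𝓓.act (Xf g) (𝓓.act (Xf k) f) = -𝓓.act (Xf g) (𝓓.act (Xf f) k) := by
      rw [hskew k f]
      simp [act]
    rw [hgkf]
    linear_combination -hfgk
end

section
/- Let M be a smooth manifold, H a closed 3-form on M, f,g smooth functions and X_f, X_g smooth vector fields on M such that X_f(g) + X_g(f) = 0, i_{X_f}H = 0 and i_{X_g}H = 0. Then [X_f ⊕ df, X_g ⊕ dg]_H = [X_f,X_g] ⊕ d(X_f(g)). -/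
open CartanCalculus

/-- For a closed 3-form `H` and isotropic admissible pairs
`X_f ⊕ df`, `X_g ⊕ dg` (i.e. `X_f(g) + X_g(f) = 0`, `i_{X_f} H = 0`,
`i_{X_g} H = 0`), the `H`-twisted Courant bracket is
`[X_f ⊕ df, X_g ⊕ dg]_H = [X_f, X_g] ⊕ d(X_f(g))`. -/
theorem twisted_bracket_of_admissible_pairs
    {C V Ω1 Ω2 Ω3 Ω4 : Type*} [CommRing C] [Algebra ℝ C]
    [AddCommGroup V] [Module ℝ V] [Module C V] [IsScalarTower ℝ C V]
    [AddCommGroup Ω1] [Module ℝ Ω1] [Module C Ω1] [IsScalarTower ℝ C Ω1]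
    [AddCommGroup Ω2] [Module ℝ Ω2] [Module C Ω2] [IsScalarTower ℝ C Ω2]
    [AddCommGroup Ω3] [Module ℝ Ω3] [Module C Ω3] [IsScalarTower ℝ C Ω3]
    [AddCommGroup Ω4] [Module ℝ Ω4] [Module C Ω4] [IsScalarTower ℝ C Ω4]
    (𝓓 : CartanCalculus C V Ω1 Ω2 Ω3 Ω4)
    (H : Ω3) (hHcl : 𝓓.d3 H = 0)
    (f g : C) (Xf Xg : V)
    (hiso : 𝓓.act Xf g + 𝓓.act Xg f = 0)
    (hf : 𝓓.ι3 Xf H = 0) (hg : 𝓓.ι3 Xg H = 0) :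
    𝓓.courantH H (Xf, 𝓓.dC f) (Xg, 𝓓.dC g)
      = (𝓓.lie Xf Xg, 𝓓.dC (𝓓.act Xf g)) := by
  have hgf : 𝓓.ι1 Xg (𝓓.dC f) = -𝓓.ι1 Xf (𝓓.dC g) := eq_neg_of_add_eq_zero_right hiso
  refine Prod.ext rfl ?_
  simp only [courantH, courant, L1, act, d1_dC, hf, hgf, map_zero, map_neg, map_sub, add_zero,
    sub_zero]
  module
end

section
/- Let M be a smooth manifold, n ≥ 1, and H a closed (n+1)-form on M. Let D be a set of pairs (X, α), with X a smooth vector field and α a smooth (n−1)-form on M, such that: (a) i_X β + i_Y α = 0 for all (X,α),(Y,β) ∈ D (isotropy); (b) D is closed under the H-twisted Courant bracket [(X,α),(Y,β)]_H = ([X,Y], L_X β − L_Y α − ½ d(i_X β − i_Y α) − i_Y i_X H); and (c) every (X,α) ∈ D satisfies dα + i_X H = 0 (admissibility). Then the image D' := {(X, dα) : (X,α) ∈ D}, consisting of pairs of a vector field and an n-form, is isotropic (i.e. i_X dβ + i_Y dα = 0 for all (X,dα),(Y,dβ) ∈ D') and is closed under the untwisted Courant bracket [(X,γ),(Y,δ)]_C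 = ([X,Y], L_X δ − L_Y γ − ½ d(i_X δ − i_Y γ)). -/
/-!
Abstract graded Cartan calculus on a smooth manifold `M`.

`V` plays the role of the smooth vector fields `𝔛(M)` and `Ω n` of the smooth
differential `n`-forms on `M`, together with the Lie bracket `lie` of vector
fields, the exterior derivative `d n : Ω n → Ω (n+1)` and the interior product
`ι n : V → Ω (n+1) → Ω n`, subject to the standard identities of Cartan
calculus.  The Lie derivative is recovered by Cartan's magic formula
`L_X = d ∘ i_X + i_X ∘ d` (on 0-forms, `L_X = i_X ∘ d`); the fields `ι_lie_zero`
and `ι_lie` express the standard identity `i_{[X,Y]} = L_X ∘ i_Y − i_Y ∘ L_X`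
with the Lie derivatives expanded through Cartan's magic formula.
-/
structure GradedCartanCalculus (V : Type*) (Ω : ℕ → Type*)
    [AddCommGroup V] [Module ℝ V]
    [∀ n, AddCommGroup (Ω n)] [∀ n, Module ℝ (Ω n)] where
  /-- the Lie bracket of vector fields -/
  lie : V →ₗ[ℝ] V →ₗ[ℝ] V
  /-- the exterior derivative on `n`-forms -/
  d : ∀ n, Ω n →ₗ[ℝ] Ω (n + 1)
  /-- the interior product of a vector field with an `(n+1)`-form -/
  ι : ∀ n, V →ₗ[ℝ] Ω (n + 1) →ₗ[ℝ] Ω n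
  lie_skew : ∀ X Y, lie X Y = - lie Y X
  lie_jacobi : ∀ X Y Z, lie (lie X Y) Z = lie X (lie Y Z) - lie Y (lie X Z)
  d_d : ∀ n (ω : Ω n), d (n + 1) (d n ω) = 0
  ι_ι : ∀ n (X : V) (ω : Ω (n + 2)), ι n X (ι (n + 1) X ω) = 0
  ι_lie_zero : ∀ (X Y : V) (ω : Ω 1),
    ι 0 (lie X Y) ω = ι 0 X (d 0 (ι 0 Y ω)) - ι 0 Y (d 0 (ι 0 X ω) + ι 1 X (d 1 ω))
  ι_lie : ∀ n (X Y : V) (ω : Ω (n + 2)),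
    ι (n + 1) (lie X Y) ω
      = (d n (ι n X (ι (n + 1) Y ω)) + ι (n + 1) X (d (n + 1) (ι (n + 1) Y ω)))
        - ι (n + 1) Y (d (n + 1) (ι (n + 1) X ω) + ι (n + 2) X (d (n + 2) ω))

namespace GradedCartanCalculus

variable {V : Type*} {Ω : ℕ → Type*}
    [AddCommGroup V] [Module ℝ V]
    [∀ n, AddCommGroup (Ω n)] [∀ n, Module ℝ (Ω n)]
    (𝓖 : GradedCartanCalculus V Ω)

/-- The untwisted Courant bracket
`[(X, γ), (Y, δ)]_C = ([X,Y], L_X δ − L_Y γ − ½ d (i_X δ − i_Y γ))`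
on pairs of a vector field and an `(m+1)`-form, the Lie derivative being given
by Cartan's magic formula `L_X = d ∘ i_X + i_X ∘ d`. -/
noncomputable def courantC (m : ℕ) (A B : V × Ω (m + 1)) : V × Ω (m + 1) :=
  (𝓖.lie A.1 B.1,
    (𝓖.d m (𝓖.ι m A.1 B.2) + 𝓖.ι (m + 1) A.1 (𝓖.d (m + 1) B.2))
      - (𝓖.d m (𝓖.ι m B.1 A.2) + 𝓖.ι (m + 1) B.1 (𝓖.d (m + 1) A.2))
      - (2⁻¹ : ℝ) • 𝓖.d m (𝓖.ι m A.1 B.2 - 𝓖.ι m B.1 A.2))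

/-- The `H`-twisted Courant bracket
`[(X, α), (Y, β)]_H = ([X,Y], L_X β − L_Y α − ½ d (i_X β − i_Y α) − i_Y i_X H)`
on pairs of a vector field and an `(m+1)`-form, for a twisting `(m+3)`-form
`H`. -/
noncomputable def courantH (m : ℕ) (H : Ω (m + 3)) (A B : V × Ω (m + 1)) :
    V × Ω (m + 1) :=
  ((𝓖.courantC m A B).1,
    (𝓖.courantC m A B).2 - 𝓖.ι (m + 1) B.1 (𝓖.ι (m + 2) A.1 H))

/-- The `H`-twisted Courant bracket on pairs of a vector field and a 0-form
(the case `n = 1`), for a twisting 2-form `H`: here the interior product of a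
vector field with a 0-form vanishes, so
`[(X, α), (Y, β)]_H = ([X,Y], L_X β − L_Y α − i_Y i_X H)` with `L_X β = i_X dβ`. -/
noncomputable def courantH0 (H : Ω 2) (A B : V × Ω 0) : V × Ω 0 :=
  (𝓖.lie A.1 B.1,
    𝓖.ι 0 A.1 (𝓖.d 0 B.2) - 𝓖.ι 0 B.1 (𝓖.d 0 A.2) - 𝓖.ι 0 B.1 (𝓖.ι 1 A.1 H))

end GradedCartanCalculus

open GradedCartanCalculus

namespace GradedCartanCalculus

variable {V : Type*} {Ω : ℕ → Type*}
    [AddCommGroup V] [Module ℝ V]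
    [∀ n, AddCommGroup (Ω n)] [∀ n, Module ℝ (Ω n)]
    (𝓖 : GradedCartanCalculus V Ω)

/-- Interior products by two vector fields anticommute. -/
theorem ι_ι_add_swap (n : ℕ) (X Y : V) (ω : Ω (n + 2)) :
    𝓖.ι n X (𝓖.ι (n + 1) Y ω) + 𝓖.ι n Y (𝓖.ι (n + 1) X ω) = 0 := by
  have h := 𝓖.ι_ι n (X + Y) ω
  simpa only [map_add, LinearMap.add_apply, 𝓖.ι_ι, zero_add, add_zero, add_comm] using h

/-- The pairs `(X, dα)` and `(Y, dβ)` are orthogonal when `(X, α)` and `(Y, β)` are admissible. -/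
theorem ι_d_add_swap_of_admissible (k : ℕ) (H : Ω (k + 2)) {X Y : V} {α β : Ω k}
    (hα : 𝓖.d k α + 𝓖.ι (k + 1) X H = 0) (hβ : 𝓖.d k β + 𝓖.ι (k + 1) Y H = 0) :
    𝓖.ι k X (𝓖.d k β) + 𝓖.ι k Y (𝓖.d k α) = 0 := by
  rw [eq_neg_of_add_eq_zero_left hα, eq_neg_of_add_eq_zero_left hβ, map_neg, map_neg, ← neg_add,
    𝓖.ι_ι_add_swap, neg_zero]

/-- The untwisted Courant bracket of `(X, dα)` and `(Y, dβ)`, for admissible `(X, α)` and `(Y, β)`,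
expressed through the exact part of the twisted bracket. -/
theorem courantC_d_of_admissible (k : ℕ) (H : Ω (k + 2)) {X Y : V} {α β : Ω k}
    (hα : 𝓖.d k α + 𝓖.ι (k + 1) X H = 0) (hβ : 𝓖.d k β + 𝓖.ι (k + 1) Y H = 0) :
    𝓖.courantC k (X, 𝓖.d k α) (Y, 𝓖.d k β) =
      (𝓖.lie X Y, 𝓖.d k (𝓖.ι k X (𝓖.d k β) - 𝓖.ι k Y (𝓖.d k α)
        - 𝓖.ι k Y (𝓖.ι (k + 1) X H))) := by
  have hiso := eq_neg_of_add_eq_zero_right (𝓖.ι_d_add_swap_of_admissible k H hα hβ)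
  have hX : 𝓖.ι (k + 1) X H = -𝓖.d k α := eq_neg_of_add_eq_zero_right hα
  simp only [courantC, 𝓖.d_d, hX, map_neg, map_zero, map_sub, hiso, Prod.mk.injEq, true_and]
  module

end GradedCartanCalculus

/-- Let `n ≥ 1` and let `H` be a closed `(n+1)`-form.  Let `D`
be a set of pairs of a vector field and an `(n−1)`-form which is isotropic
(`i_X β + i_Y α = 0` for all `(X,α), (Y,β) ∈ D`; for `n = 1` this condition is
vacuous, the interior product of a 0-form being zero), closed under the
`H`-twisted Courant bracket, and all of whose elements are admissible
(`dα + i_X H = 0`).  Then the image `D' = {(X, dα) : (X, α) ∈ D}` is isotropic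
(`i_X dβ + i_Y dα = 0`) and closed under the untwisted Courant bracket.

The case `n ≥ 2` is stated with `n = m + 2` (so that `α : Ω (m+1)`,
`H : Ω (m+3)`), and the case `n = 1` (where `α : Ω 0`, `H : Ω 2`) separately. -/
theorem image_of_twisted_admissible_is_dirac
    {V : Type*} {Ω : ℕ → Type*}
    [AddCommGroup V] [Module ℝ V]
    [∀ n, AddCommGroup (Ω n)] [∀ n, Module ℝ (Ω n)]
    (𝓖 : GradedCartanCalculus V Ω)
 :
    -- the case `n = m + 2 ≥ 2`
    (∀ (m : ℕ) (H : Ω (m + 3)) (D : Set (V × Ω (m + 1))),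
      𝓖.d (m + 3) H = 0 →
      (∀ A ∈ D, ∀ B ∈ D, 𝓖.ι m A.1 B.2 + 𝓖.ι m B.1 A.2 = 0) →
      (∀ A ∈ D, ∀ B ∈ D, 𝓖.courantH m H A B ∈ D) →
      (∀ A ∈ D, 𝓖.d (m + 1) A.2 + 𝓖.ι (m + 2) A.1 H = 0) →
      (∀ A ∈ D, ∀ B ∈ D,
          𝓖.ι (m + 1) A.1 (𝓖.d (m + 1) B.2)
            + 𝓖.ι (m + 1) B.1 (𝓖.d (m + 1) A.2) = 0)
      ∧ (∀ A ∈ D, ∀ B ∈ D,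
          𝓖.courantC (m + 1) (A.1, 𝓖.d (m + 1) A.2) (B.1, 𝓖.d (m + 1) B.2)
            ∈ {p : V × Ω (m + 2) | ∃ q ∈ D, p = (q.1, 𝓖.d (m + 1) q.2)}))
    ∧ -- the case `n = 1`
    (∀ (H : Ω 2) (D : Set (V × Ω 0)),
      𝓖.d 2 H = 0 →
      (∀ A ∈ D, ∀ B ∈ D, 𝓖.courantH0 H A B ∈ D) →
      (∀ A ∈ D, 𝓖.d 0 A.2 + 𝓖.ι 1 A.1 H = 0) →
      (∀ A ∈ D, ∀ B ∈ D,
          𝓖.ι 0 A.1 (𝓖.d 0 B.2) + 𝓖.ι 0 B.1 (𝓖.d 0 A.2) = 0)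
      ∧ (∀ A ∈ D, ∀ B ∈ D,
          𝓖.courantC 0 (A.1, 𝓖.d 0 A.2) (B.1, 𝓖.d 0 B.2)
            ∈ {p : V × Ω 1 | ∃ q ∈ D, p = (q.1, 𝓖.d 0 q.2)})) := by
  refine ⟨fun m H D _ _ hbr hadm => ⟨fun A hA B hB => ?_, fun A hA B hB => ?_⟩,
    fun H D _ hbr hadm => ⟨fun A hA B hB => ?_, fun A hA B hB => ?_⟩⟩
  · exact 𝓖.ι_d_add_swap_of_admissible (m + 1) H (hadm A hA) (hadm B hB)
  · refine ⟨_, hbr A hA B hB, ?_⟩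
    rw [𝓖.courantC_d_of_admissible (m + 1) H (hadm A hA) (hadm B hB)]
    simp only [courantH, courantC, map_sub, map_add, map_smul, 𝓖.d_d, zero_add, smul_zero,
      sub_zero, sub_self]
  · exact 𝓖.ι_d_add_swap_of_admissible 0 H (hadm A hA) (hadm B hB)
  · exact ⟨_, hbr A hA B hB, 𝓖.courantC_d_of_admissible 0 H (hadm A hA) (hadm B hB)⟩
end

section
/- Let M be a smooth manifold, f,g,h smooth functions, and X_f, X_g, X_h smooth vector fields on M satisfying the pairwise isotropy conditions X_f(g) + X_g(f) = 0, X_g(h) + X_h(g) = 0, X_f(h) + X_h(f) = 0. Define {a,b} := X_a(b). Then 2⟨[X_f ⊕ df, X_g ⊕ dg]_C, X_h ⊕ dh⟩₊ = {f,{g,h}} + {g,{h,f}} + {h,{f,g}}. -/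
open CartanCalculus

/-- For smooth functions `f, g, h` and vector fields
`X_f, X_g, X_h` with pairwise isotropic pairs (`X_f(g) + X_g(f) = 0` etc.),
with `{a, b} := X_a(b)`, twice the pairing of the (untwisted) Courant bracket
`[X_f ⊕ df, X_g ⊕ dg]_C` with `X_h ⊕ dh` equals the Jacobiator
`{f,{g,h}} + {g,{h,f}} + {h,{f,g}}`. -/
theorem courant_tensor_eq_jacobiator
    {C V Ω1 Ω2 Ω3 Ω4 : Type*} [CommRing C] [Algebra ℝ C]
    [AddCommGroup V] [Module ℝ V] [Module C V] [IsScalarTower ℝ C V]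
    [AddCommGroup Ω1] [Module ℝ Ω1] [Module C Ω1] [IsScalarTower ℝ C Ω1]
    [AddCommGroup Ω2] [Module ℝ Ω2] [Module C Ω2] [IsScalarTower ℝ C Ω2]
    [AddCommGroup Ω3] [Module ℝ Ω3] [Module C Ω3] [IsScalarTower ℝ C Ω3]
    [AddCommGroup Ω4] [Module ℝ Ω4] [Module C Ω4] [IsScalarTower ℝ C Ω4]
    (𝓓 : CartanCalculus C V Ω1 Ω2 Ω3 Ω4)
    (f g h : C) (Xf Xg Xh : V)
    (hfg : 𝓓.act Xf g + 𝓓.act Xg f = 0)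
    (hgh : 𝓓.act Xg h + 𝓓.act Xh g = 0)
    (hfh : 𝓓.act Xf h + 𝓓.act Xh f = 0) :
    (2 : ℝ) • 𝓓.pairPlus (𝓓.courant (Xf, 𝓓.dC f) (Xg, 𝓓.dC g)) (Xh, 𝓓.dC h)
      = 𝓓.act Xf (𝓓.act Xg h) + 𝓓.act Xg (𝓓.act Xh f)
        + 𝓓.act Xh (𝓓.act Xf g) := by
  simp only [act] at hfg hfh ⊢
  have hg : 𝓓.ι1 Xg (𝓓.dC f) = -𝓓.ι1 Xf (𝓓.dC g) := eq_neg_of_add_eq_zero_right hfg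
  have hh : 𝓓.ι1 Xh (𝓓.dC f) = -𝓓.ι1 Xf (𝓓.dC h) := eq_neg_of_add_eq_zero_right hfh
  have hform : (𝓓.courant (Xf, 𝓓.dC f) (Xg, 𝓓.dC g)).2 = 𝓓.dC (𝓓.ι1 Xf (𝓓.dC g)) := by
    simp only [courant, L1, 𝓓.d1_dC, hg, map_zero, add_zero, map_sub, map_neg]
    module
  have hvec : 𝓓.ι1 (𝓓.lie Xf Xg) (𝓓.dC h)
      = 𝓓.ι1 Xf (𝓓.dC (𝓓.ι1 Xg (𝓓.dC h))) - 𝓓.ι1 Xg (𝓓.dC (𝓓.ι1 Xf (𝓓.dC h))) := by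
    simp only [𝓓.ι1_lie, 𝓓.d1_dC, map_zero, add_zero]
  rw [pairPlus, smul_inv_smul₀ two_ne_zero, hform]
  simp only [courant, hvec, hh, map_neg]
  ring
end

section
/- Let M be a smooth manifold, H a closed 3-form on M, f,g,h smooth functions, and X_f, X_g, X_h smooth vector fields on M satisfying the pairwise isotropy conditions X_f(g) + X_g(f) = 0, X_g(h) + X_h(g) = 0, X_f(h) + X_h(f) = 0. Define {a,b} := X_a(b). Then 2⟨[X_f ⊕ df, X_g ⊕ dg]_H, X_h ⊕ dh⟩₊ = {f,{g,h}} + {g,{h,f}} + {h,{f,g}} − H(X_f, X_g, X_h). -/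
open CartanCalculus

/-- For a closed 3-form `H`, smooth functions `f, g, h` and
vector fields `X_f, X_g, X_h` with pairwise isotropic pairs
(`X_f(g) + X_g(f) = 0` etc.), with `{a, b} := X_a(b)`, twice the pairing of the
`H`-twisted Courant bracket `[X_f ⊕ df, X_g ⊕ dg]_H` with `X_h ⊕ dh` equals
`{f,{g,h}} + {g,{h,f}} + {h,{f,g}} − H(X_f, X_g, X_h)`. -/
theorem twisted_courant_tensor_eq_jacobiator_sub_H
    {C V Ω1 Ω2 Ω3 Ω4 : Type*} [CommRing C] [Algebra ℝ C]
    [AddCommGroup V] [Module ℝ V] [Module C V] [IsScalarTower ℝ C V]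
    [AddCommGroup Ω1] [Module ℝ Ω1] [Module C Ω1] [IsScalarTower ℝ C Ω1]
    [AddCommGroup Ω2] [Module ℝ Ω2] [Module C Ω2] [IsScalarTower ℝ C Ω2]
    [AddCommGroup Ω3] [Module ℝ Ω3] [Module C Ω3] [IsScalarTower ℝ C Ω3]
    [AddCommGroup Ω4] [Module ℝ Ω4] [Module C Ω4] [IsScalarTower ℝ C Ω4]
    (𝓓 : CartanCalculus C V Ω1 Ω2 Ω3 Ω4)
    (H : Ω3) (hHcl : 𝓓.d3 H = 0)
    (f g h : C) (Xf Xg Xh : V)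
    (hfg : 𝓓.act Xf g + 𝓓.act Xg f = 0)
    (hgh : 𝓓.act Xg h + 𝓓.act Xh g = 0)
    (hfh : 𝓓.act Xf h + 𝓓.act Xh f = 0) :
    (2 : ℝ) • 𝓓.pairPlus (𝓓.courantH H (Xf, 𝓓.dC f) (Xg, 𝓓.dC g)) (Xh, 𝓓.dC h)
      = 𝓓.act Xf (𝓓.act Xg h) + 𝓓.act Xg (𝓓.act Xh f) + 𝓓.act Xh (𝓓.act Xf g)
        - 𝓓.ι1 Xh (𝓓.ι2 Xg (𝓓.ι3 Xf H)) := by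
  have hgf : 𝓓.ι1 Xg (𝓓.dC f) = - 𝓓.ι1 Xf (𝓓.dC g) := eq_neg_of_add_eq_zero_right hfg
  have hfh' : 𝓓.ι1 Xf (𝓓.dC h) = - 𝓓.ι1 Xh (𝓓.dC f) := eq_neg_of_add_eq_zero_left hfh
  simp only [pairPlus, courantH, courant, L1, act, 𝓓.d1_dC, 𝓓.ι1_lie, map_zero, add_zero,
    map_sub, map_smul, map_neg, hgf, hfh']
  module
end

section
/- Let M be a smooth manifold, n ≥ 1, H a closed (n+1)-form on M, X, Y smooth vector fields, and α, β smooth (n−1)-forms with dα + i_X H = 0 and dβ + i_Y H = 0. Then the untwisted Courant bracket of the pairs (X, dα) and (Y, dβ) is [(X,dα),(Y,dβ)]_C = ([X,Y], −i_{[X,Y]}H). -/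
open GradedCartanCalculus

/-- Interior products anticommute. -/
theorem GradedCartanCalculus.ι_anticomm {V : Type*} {Ω : ℕ → Type*}
    [AddCommGroup V] [Module ℝ V]
    [∀ n, AddCommGroup (Ω n)] [∀ n, Module ℝ (Ω n)]
    (𝓖 : GradedCartanCalculus V Ω) (n : ℕ) (X Y : V) (ω : Ω (n + 2)) :
    𝓖.ι n Y (𝓖.ι (n + 1) X ω) = - 𝓖.ι n X (𝓖.ι (n + 1) Y ω) := by
  have h := 𝓖.ι_ι n (X + Y) ω
  simp only [map_add, LinearMap.add_apply, 𝓖.ι_ι, zero_add, add_zero] at h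
  exact eq_neg_of_add_eq_zero_left h

/-- Let `n ≥ 1` (here `n = m + 1`), `H` a closed `(n+1)`-form,
and `(X, α)`, `(Y, β)` admissible pairs of vector fields and `(n−1)`-forms,
i.e. `dα + i_X H = 0` and `dβ + i_Y H = 0`.  Then the untwisted Courant bracket
of the image pairs is `[(X, dα), (Y, dβ)]_C = ([X,Y], − i_{[X,Y]} H)`. -/
theorem courant_bracket_of_admissible_images
    {V : Type*} {Ω : ℕ → Type*}
    [AddCommGroup V] [Module ℝ V]
    [∀ n, AddCommGroup (Ω n)] [∀ n, Module ℝ (Ω n)]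
    (𝓖 : GradedCartanCalculus V Ω)
 :
    ∀ (m : ℕ) (H : Ω (m + 2)) (X Y : V) (α β : Ω m),
      𝓖.d (m + 2) H = 0 →
      𝓖.d m α + 𝓖.ι (m + 1) X H = 0 → 𝓖.d m β + 𝓖.ι (m + 1) Y H = 0 →
      𝓖.courantC m (X, 𝓖.d m α) (Y, 𝓖.d m β)
        = (𝓖.lie X Y, - 𝓖.ι (m + 1) (𝓖.lie X Y) H) := by
  intro m H X Y α β hH hα hβ
  have hX : 𝓖.ι (m + 1) X H = - 𝓖.d m α := eq_neg_of_add_eq_zero_right hα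
  have hY : 𝓖.ι (m + 1) Y H = - 𝓖.d m β := eq_neg_of_add_eq_zero_right hβ
  have hXY : 𝓖.ι m Y (𝓖.d m α) = - 𝓖.ι m X (𝓖.d m β) := by
    simpa [hX, hY, neg_eq_iff_eq_neg] using 𝓖.ι_anticomm m X Y H
  have hlie : 𝓖.ι (m + 1) (𝓖.lie X Y) H = - 𝓖.d m (𝓖.ι m X (𝓖.d m β)) := by
    simp [𝓖.ι_lie, hX, hY, hH, 𝓖.d_d]
  refine Prod.ext rfl ?_
  simp only [courantC, 𝓖.d_d, hXY, hlie, map_zero, map_neg, map_sub, add_zero]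
  module
end
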